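/- The set of all pruned trees T of strictly increasing finite sequences of naturals such that the closed set C_T ⊆ [ω]^ω coded by T is Ramsey positive is an analytic subset of the space 2^(ℕ^{<ℕ}) of sets of finite sequences of naturals. -/

import Mathlib

open MeasureTheory TopologicalSpace

/-- The space `[ω]^ω` of infinite subsets of `ℕ`, topologized as a subspace of the
Cantor space `ℕ → Bool` via characteristic functions. -/
abbrev IOI := {x : ℕ → Bool // {n | x n = true}.Infinite}

/-- A set is `Σ¹₂` if it is the image of a coanalytic subset of Baire space under a
continuous map. -/
def Sigma12 {X : Type*} [TopologicalSpace X] (A : Set X) : Prop :=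
  ∃ (C : Set (ℕ → ℕ)) (f : (ℕ → ℕ) → X),
    MeasureTheory.AnalyticSet Cᶜ ∧ Continuous f ∧ f '' C = A

/-- A topological space is zero-dimensional if it has a basis of clopen sets. -/
def ZeroDim (X : Type*) [TopologicalSpace X] : Prop :=
  ∃ b : Set (Set X), (∀ s ∈ b, IsClopen s) ∧ TopologicalSpace.IsTopologicalBasis b

/-- `A` is `Σ¹₂`-complete: `A` is `Σ¹₂` and every `Σ¹₂` subset of a zero-dimensional
Polish space is a continuous preimage of `A`. -/
def Sigma12Complete {X : Type*} [TopologicalSpace X] (A : Set X) : Prop :=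
  Sigma12 A ∧
  ∀ (Z : Type) [TopologicalSpace Z] [PolishSpace Z], ZeroDim Z →
    ∀ B : Set Z, Sigma12 B → ∃ f : Z → X, Continuous f ∧ f ⁻¹' A = B

/-- The Ellentuck basic set `[σ,s]`: all infinite `a ⊆ ℕ` with `a ∩ {0,…,max σ} = σ`
and every element of `a` greater than `max σ` lying in `s` (stated max-free:
`σ ⊆ a`, and every element of `a` outside `σ` lies in `s` and is above all of `σ`). -/
def ES (σ : Finset ℕ) (s : Set ℕ) : Set IOI :=
  {a | (∀ m ∈ σ, a.1 m = true) ∧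
       ∀ n, a.1 n = true → n ∉ σ → n ∈ s ∧ ∀ m ∈ σ, m < n}

/-- A legitimate Ellentuck pair: `s` is infinite and `max σ < min s`. -/
def GoodPair (σ : Finset ℕ) (s : Set ℕ) : Prop :=
  s.Infinite ∧ ∀ m ∈ σ, ∀ n ∈ s, m < n

/-- `A ⊆ [ω]^ω` is Ramsey null if every Ellentuck basic set `[σ,s]` can be shrunk to
`[σ,s']` (with `s' ⊆ s` infinite, `min s' > max σ`) disjoint from `A`. -/
def RamseyNull (A : Set IOI) : Prop :=
  ∀ σ : Finset ℕ, ∀ s : Set ℕ, GoodPair σ s →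
    ∃ s' ⊆ s, s'.Infinite ∧ (∀ m ∈ σ, ∀ n ∈ s', m < n) ∧ ES σ s' ∩ A = ∅

/-- `A` is Ramsey positive if it is not Ramsey null. -/
def RamseyPositive (A : Set IOI) : Prop := ¬ RamseyNull A

/-- A pruned tree of strictly increasing finite sequences of naturals: nonempty
(contains the empty sequence), all members strictly increasing, closed under
initial segments, and every member has a proper extension in the tree. -/
def PrunedIncTree (T : List ℕ → Bool) : Prop :=
  T [] = true ∧
  (∀ l, T l = true → List.Chain' (· < ·) l) ∧
  (∀ l n, T (l ++ [n]) = true → T l = true) ∧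
  (∀ l, T l = true → ∃ n, T (l ++ [n]) = true)

/-- The initial segment of length `k` of the increasing enumeration of `a ∈ [ω]^ω`. -/
noncomputable def enumList (a : IOI) (k : ℕ) : List ℕ :=
  (List.range k).map (Nat.nth fun n => a.1 n = true)

/-- The closed set `C_T ⊆ [ω]^ω` coded by `T`: all `a` all of whose
increasing-enumeration initial segments lie in `T`. -/
def treeClosedSet (T : List ℕ → Bool) : Set IOI :=
  {a | ∀ k, T (enumList a k) = true}

/-- Fusion for a hereditary, dense property of pairs (finite set, infinite set). -/
theorem exists_infinite_subset_forall_finset {Q : Finset ℕ → Set ℕ → Prop} {s : Set ℕ}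
    (hs : s.Infinite)
    (hered : ∀ τ t t', t' ⊆ t → t'.Infinite → Q τ t → Q τ t')
    (dense : ∀ τ t, t ⊆ s → t.Infinite → ∃ t' ⊆ t, t'.Infinite ∧ Q τ t') :
    ∃ s' ⊆ s, s'.Infinite ∧
      ∀ τ : Finset ℕ, ↑τ ⊆ s' → Q τ {n ∈ s' | ∀ m ∈ τ, m < n} := by
  have finite_step : ∀ (𝒯 : Finset (Finset ℕ)) (t : Set ℕ), t ⊆ s → t.Infinite →
      ∃ t' ⊆ t, t'.Infinite ∧ ∀ τ ∈ 𝒯, Q τ t' := by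
    intro 𝒯
    induction 𝒯 using Finset.induction_on with
    | empty => exact fun t _ ht => ⟨t, subset_rfl, ht, by simp⟩
    | insert τ 𝒯 _ ih =>
      intro t hts ht
      obtain ⟨t₁, h₁, hi₁, hQ₁⟩ := ih t hts ht
      obtain ⟨t₂, h₂, hi₂, hQ₂⟩ := dense τ t₁ (h₁.trans hts) hi₁
      refine ⟨t₂, h₂.trans h₁, hi₂, fun ρ hρ => ?_⟩
      rcases Finset.mem_insert.1 hρ with rfl | hρ
      · exact hQ₂
      · exact hered _ _ _ h₂ hi₂ (hQ₁ _ hρ)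
  have succ_step : ∀ t : {t : Set ℕ // t ⊆ s ∧ t.Infinite},
      ∃ t' : {t : Set ℕ // t ⊆ s ∧ t.Infinite}, t'.1 ⊆ {n ∈ t.1 | sInf t.1 < n} ∧
        ∀ τ ⊆ Finset.range (sInf t.1 + 1), Q τ t'.1 := by
    rintro ⟨t, hts, ht⟩
    have hinf : {n ∈ t | sInf t < n}.Infinite :=
      (ht.sdiff (Set.finite_Iic (sInf t))).mono fun n hn => ⟨hn.1, not_le.1 hn.2⟩
    obtain ⟨t', h', hi', hQ'⟩ := finite_step (Finset.range (sInf t + 1)).powerset _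
      (fun n hn => hts hn.1) hinf
    exact ⟨⟨t', fun n hn => hts (h' hn).1, hi'⟩, h', fun τ hτ => hQ' τ (by simpa using hτ)⟩
  choose next hnext hQnext using succ_step
  obtain ⟨t₀, h₀, hi₀, hQ₀⟩ := dense ∅ s subset_rfl hs
  let S : ℕ → {t : Set ℕ // t ⊆ s ∧ t.Infinite} := fun i => next^[i] ⟨t₀, h₀, hi₀⟩
  have hS : ∀ i, S (i + 1) = next (S i) := fun i => Function.iterate_succ_apply' _ _ _
  have hanti : Antitone fun i => (S i).1 := antitone_nat_of_succ_le fun i n hn => by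
    rw [hS] at hn
    exact (hnext _ hn).1
  let x : ℕ → ℕ := fun i => sInf (S i).1
  have hx : ∀ i, x i ∈ (S i).1 := fun i => Nat.sInf_mem (S i).2.2.nonempty
  have hmono : StrictMono x := strictMono_nat_of_lt_succ fun i => by
    have h := hx (i + 1)
    rw [hS] at h
    exact (hnext _ h).2
  have hinf : (Set.range x).Infinite := Set.infinite_range_of_injective hmono.injective
  refine ⟨Set.range x, ?_, hinf, fun τ hτ => ?_⟩
  · rintro _ ⟨i, rfl⟩
    exact (S i).2.1 (hx i)
  have hinf' : {n ∈ Set.range x | ∀ m ∈ τ, m < n}.Infinite :=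
    (hinf.sdiff (Set.finite_Iic (τ.sup id))).mono fun n hn =>
      ⟨hn.1, fun m hm => (Finset.le_sup (f := id) hm).trans_lt (not_le.1 hn.2)⟩
  rcases τ.eq_empty_or_nonempty with rfl | hne
  · refine hered _ t₀ _ ?_ hinf' hQ₀
    rintro _ ⟨⟨i, rfl⟩, -⟩
    exact hanti (Nat.zero_le i) (hx i)
  · obtain ⟨i, hi⟩ := hτ (τ.max'_mem hne)
    refine hered _ (S (i + 1)).1 _ ?_ hinf' ?_
    · rintro _ ⟨⟨j, rfl⟩, hj⟩
      have hij : x i < x j := by rw [hi]; exact hj _ (τ.max'_mem hne)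
      exact hanti (Nat.succ_le_of_lt (hmono.lt_iff_lt.1 hij)) (hx j)
    · rw [hS]
      refine hQnext _ τ fun m hm => ?_
      have : m ≤ x i := by rw [hi]; exact τ.le_max' _ hm
      exact Finset.mem_range.2 (Nat.lt_succ_of_le this)

theorem ES_mono {σ : Finset ℕ} {s t : Set ℕ} (h : s ⊆ t) : ES σ s ⊆ ES σ t :=
  fun _ ha => ⟨ha.1, fun n hn hσ => ⟨h (ha.2 n hn hσ).1, (ha.2 n hn hσ).2⟩⟩

theorem ES_union_subset (σ τ : Finset ℕ) (s : Set ℕ) :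
    ES (σ ∪ τ) s ⊆ ES (σ ∪ τ) {n ∈ s | ∀ m ∈ τ, m < n} :=
  fun _ ha => ⟨ha.1, fun n hn hσ =>
    ⟨⟨(ha.2 n hn hσ).1, fun m hm => (ha.2 n hn hσ).2 m (Finset.mem_union_right _ hm)⟩,
      (ha.2 n hn hσ).2⟩⟩

/-- Every member of `[σ,s]` lies in some `[σ ∪ {n},s]` with `n ∈ s` above `σ`. -/
theorem exists_mem_ES_insert {σ : Finset ℕ} {s : Set ℕ} {a : IOI} (ha : a ∈ ES σ s) :
    ∃ n ∈ s, (∀ m ∈ σ, m < n) ∧ a ∈ ES (insert n σ) s := by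
  classical
  have hex : ∃ n, a.1 n = true ∧ n ∉ σ := by
    obtain ⟨n, hn, hσ⟩ := (a.2.sdiff σ.finite_toSet).nonempty
    exact ⟨n, hn, hσ⟩
  obtain ⟨hn, hσ⟩ := Nat.find_spec hex
  refine ⟨Nat.find hex, (ha.2 _ hn hσ).1, (ha.2 _ hn hσ).2, ?_, fun k hk hkσ => ?_⟩
  · intro m hm
    rcases Finset.mem_insert.1 hm with rfl | hm
    · exact hn
    · exact ha.1 m hm
  · rw [Finset.mem_insert, not_or] at hkσ
    refine ⟨(ha.2 k hk hkσ.2).1, fun m hm => ?_⟩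
    rcases Finset.mem_insert.1 hm with rfl | hm
    · exact lt_of_le_of_ne (Nat.find_min' hex ⟨hk, hkσ.2⟩) (Ne.symm hkσ.1)
    · exact (ha.2 k hk hkσ.2).2 m hm

/-- Open subsets of `[ω]^ω` are Ramsey. -/
theorem exists_ES_subset_or_disjoint {U : Set IOI}
    (hU : ∀ a ∈ U, ∃ N, ∀ b : IOI, (∀ n < N, b.1 n = a.1 n) → b ∈ U)
    {σ : Finset ℕ} {s : Set ℕ} (hσs : GoodPair σ s) :
    ∃ s' ⊆ s, s'.Infinite ∧ (ES σ s' ⊆ U ∨ ES σ s' ∩ U = ∅) := by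
  classical
  let Rejects : Finset ℕ → Set ℕ → Prop := fun τ t =>
    ∀ t' ⊆ t, t'.Infinite → ¬ ES (σ ∪ τ) t' ⊆ U
  obtain ⟨t, hts, ht, hdec⟩ := exists_infinite_subset_forall_finset
    (Q := fun τ t => ES (σ ∪ τ) t ⊆ U ∨ Rejects τ t) hσs.1
    (by
      rintro τ t t' htt' - (h | h)
      · exact Or.inl ((ES_mono htt').trans h)
      · exact Or.inr fun r hr => h r (hr.trans htt'))
    (by
      intro τ t _ ht
      by_cases h : Rejects τ t
      · exact ⟨t, subset_rfl, ht, Or.inr h⟩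
      · simp only [Rejects, not_forall, not_not] at h
        obtain ⟨t', h₁, h₂, h₃⟩ := h
        exact ⟨t', h₁, h₂, Or.inl h₃⟩)
  replace hdec : ∀ τ : Finset ℕ, ↑τ ⊆ t → ES (σ ∪ τ) t ⊆ U ∨ Rejects τ t := by
    intro τ hτ
    refine (hdec τ hτ).imp (ES_union_subset σ τ t).trans fun h r hr hri hrU => ?_
    refine h {n ∈ r | ∀ m ∈ τ, m < n} (fun n hn => ⟨hr hn.1, hn.2⟩) ?_
      ((ES_mono fun n hn => hn.1).trans hrU)
    exact (hri.sdiff (Set.finite_Iic (τ.sup id))).mono fun n hn =>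
      ⟨hn.1, fun m hm => (Finset.le_sup (f := id) hm).trans_lt (not_le.1 hn.2)⟩
  by_cases hrej : Rejects ∅ t
  swap
  · have h := (hdec ∅ (by simp)).resolve_right hrej
    rw [Finset.union_empty] at h
    exact ⟨t, hts, ht, Or.inl h⟩
  obtain ⟨r, hrt, hr, hext⟩ := exists_infinite_subset_forall_finset
    (Q := fun τ r => ↑τ ⊆ t → Rejects τ t → ∀ n ∈ r, Rejects (insert n τ) t) ht
    (fun τ r r' h _ hQ hτ hR n hn => hQ hτ hR n (h hn))
    (by
      intro τ r hrt hr
      by_cases hτ : ↑τ ⊆ t ∧ Rejects τ t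
      swap
      · exact ⟨r, subset_rfl, hr, fun h₁ h₂ => absurd ⟨h₁, h₂⟩ hτ⟩
      have hfin : {n ∈ r | ¬ Rejects (insert n τ) t}.Finite := by
        by_contra hinf
        refine hτ.2 _ (fun n hn => hrt hn.1) hinf fun a ha => ?_
        obtain ⟨n, hn, -, han⟩ := exists_mem_ES_insert ha
        have hsub : (↑(insert n τ) : Set ℕ) ⊆ t := by
          rw [Finset.coe_insert]
          exact Set.insert_subset (hrt hn.1) hτ.1
        refine (hdec _ hsub).resolve_right hn.2 ?_
        rw [Finset.union_insert]
        exact ES_mono (fun k hk => hrt hk.1) han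
      refine ⟨_, Set.sdiff_subset, hr.sdiff hfin, fun _ _ n hn => ?_⟩
      by_contra h
      exact hn.2 ⟨hn.1, h⟩)
  have hall : ∀ τ : Finset ℕ, ↑τ ⊆ r → Rejects τ t := by
    intro τ
    induction τ using Finset.induction_on_max with
    | empty => exact fun _ => hrej
    | insert n τ hn ih =>
      intro hτ
      rw [Finset.coe_insert, Set.insert_subset_iff] at hτ
      exact hext τ hτ.2 (hτ.2.trans hrt) (ih hτ.2) n ⟨hτ.1, hn⟩
  refine ⟨r, hrt.trans hts, hr, Or.inr (Set.eq_empty_of_forall_notMem ?_)⟩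
  rintro a ⟨ha, haU⟩
  obtain ⟨N, hN⟩ := hU a haU
  obtain ⟨M, hM, hMN⟩ := a.2.exists_gt (N + σ.sup id)
  let τ : Finset ℕ := (Finset.range (M + 1)).filter fun n => a.1 n = true ∧ n ∉ σ
  refine hall τ ?_ t subset_rfl ht fun b hb => hN b fun n hn => ?_
  · intro n hn
    have hn' := (Finset.mem_filter.1 (Finset.mem_coe.1 hn)).2
    exact (ha.2 n hn'.1 hn'.2).1
  have hMτ : M ∈ σ ∪ τ := by
    by_cases h : M ∈ σ
    · exact Finset.mem_union_left _ h
    · exact Finset.mem_union_right _ (Finset.mem_filter.2 ⟨by simp, hM, h⟩)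
  rw [Bool.eq_iff_iff]
  constructor
  · intro hbn
    by_cases hnσ : n ∈ σ ∪ τ
    · rcases Finset.mem_union.1 hnσ with h | h
      · exact ha.1 n h
      · exact (Finset.mem_filter.1 h).2.1
    · have := (hb.2 n hbn hnσ).2 M hMτ
      omega
  · intro han
    refine hb.1 n ?_
    by_cases h : n ∈ σ
    · exact Finset.mem_union_left _ h
    · exact Finset.mem_union_right _
        (Finset.mem_filter.2 ⟨Finset.mem_range.2 (by omega), han, h⟩)

/-- A finite initial part of `a` is listed by the increasing enumeration of `a`. -/
theorem enumList_card_eq_sort {a : IOI} {F : Finset ℕ} (hF : ∀ n ∈ F, a.1 n = true)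
    (hlt : ∀ n, a.1 n = true → n ∉ F → ∀ m ∈ F, m < n) :
    enumList a F.card = F.sort (· ≤ ·) := by
  classical
  have hmono : StrictMono (Nat.nth fun n => a.1 n = true) := Nat.nth_strictMono a.2
  have himage : (Finset.range F.card).image (Nat.nth fun n => a.1 n = true) = F := by
    refine Finset.eq_of_subset_of_card_le ?_ ?_
    · intro n hn
      obtain ⟨i, hi, rfl⟩ := Finset.mem_image.1 hn
      by_contra hnF
      have hbelow := hlt _ (Nat.nth_mem_of_infinite a.2 i) hnF
      have hsub : F ⊆ (Finset.range i).image (Nat.nth fun n => a.1 n = true) := by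
        intro m hm
        have hm' := Nat.nth_count (p := fun n => a.1 n = true) (hF m hm)
        refine Finset.mem_image.2 ⟨_, Finset.mem_range.2 ?_, hm'⟩
        rw [← hmono.lt_iff_lt, hm']
        exact hbelow m hm
      have hcard := (Finset.card_le_card hsub).trans Finset.card_image_le
      rw [Finset.card_range] at hcard
      exact absurd (Finset.mem_range.1 hi) (not_lt.2 hcard)
    · rw [Finset.card_image_of_injective _ hmono.injective, Finset.card_range]
  have hsorted : (enumList a F.card).Pairwise (· < ·) :=
    List.pairwise_map.2 (List.pairwise_lt_range.imp fun h => hmono h)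
  have htoFinset : (enumList a F.card).toFinset = F := by
    ext n
    conv_rhs => rw [← himage]
    simp [enumList]
  conv_rhs => rw [← htoFinset]
  exact ((List.toFinset_sort _ (hsorted.imp ne_of_lt)).2 (hsorted.imp le_of_lt)).symm

theorem enumList_eq_sort_filter (a : IOI) (k : ℕ) :
    enumList a k = ((Finset.range (Nat.nth (fun n => a.1 n = true) k)).filter
      fun n => a.1 n = true).sort (· ≤ ·) := by
  have hcard := Nat.count_nth_of_infinite (p := fun n => a.1 n = true) a.2 k
  rw [Nat.count_eq_card_filter_range] at hcard
  rw [← enumList_card_eq_sort (a := a), hcard]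
  · exact fun n hn => (Finset.mem_filter.1 hn).2
  · intro n hn hnF m hm
    simp only [Finset.mem_filter, Finset.mem_range, hn, and_true, not_lt] at hnF hm
    exact hm.1.trans_le hnF

theorem exists_forall_agree_notMem_treeClosedSet (T : List ℕ → Bool) {a : IOI}
    (ha : a ∈ (treeClosedSet T)ᶜ) :
    ∃ N, ∀ b : IOI, (∀ n < N, b.1 n = a.1 n) → b ∈ (treeClosedSet T)ᶜ := by
  obtain ⟨k, hk⟩ := not_forall.1 ha
  refine ⟨Nat.nth (fun n => a.1 n = true) k, fun b hb hbT => hk ?_⟩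
  have hcard := Nat.count_nth_of_infinite (p := fun n => a.1 n = true) a.2 k
  rw [Nat.count_eq_card_filter_range] at hcard
  rw [enumList_eq_sort_filter, ← enumList_card_eq_sort (a := b)]
  · exact hbT _
  · intro n hn
    simp only [Finset.mem_filter, Finset.mem_range] at hn
    rw [hb n hn.1, hn.2]
  · intro n hn hnF m hm
    simp only [Finset.mem_filter, Finset.mem_range, not_and] at hnF hm
    refine hm.1.trans_le (not_lt.1 fun h => hnF h ?_)
    rw [← hb n h, hn]

/-- The infinite set `A` as a point of `[ω]^ω`. -/
theorem exists_IOI_mem_iff {A : Set ℕ} (hA : A.Infinite) :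
    ∃ a : IOI, ∀ n, a.1 n = true ↔ n ∈ A := by
  classical
  exact ⟨⟨fun n => decide (n ∈ A), by simpa using hA⟩, fun n => by simp⟩

/-- A closed set coded by a tree is Ramsey positive iff it contains a basic set `[σ,s]`. -/
theorem ramseyPositive_treeClosedSet_iff (T : List ℕ → Bool) :
    RamseyPositive (treeClosedSet T) ↔
      ∃ σ s, GoodPair σ s ∧ ES σ s ⊆ treeClosedSet T := by
  constructor
  · intro h
    simp only [RamseyPositive, RamseyNull, not_forall] at h
    obtain ⟨σ, s, hσs, hpos⟩ := h
    obtain ⟨s', hs', hinf, hU | hU⟩ := exists_ES_subset_or_disjoint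
      (fun a ha => exists_forall_agree_notMem_treeClosedSet T ha) hσs
    · exact absurd ⟨s', hs', hinf, fun m hm n hn => hσs.2 m hm n (hs' hn),
        Set.disjoint_iff_inter_eq_empty.1 (Set.subset_compl_iff_disjoint_right.1 hU)⟩ hpos
    · refine ⟨σ, s', ⟨hinf, fun m hm n hn => hσs.2 m hm n (hs' hn)⟩, ?_⟩
      rwa [← Set.disjoint_iff_inter_eq_empty, Set.disjoint_compl_right_iff_subset] at hU
  · rintro ⟨σ, s, hσs, hsub⟩ hnull
    obtain ⟨s', hs', hinf, hlt, hdisj⟩ := hnull σ s hσs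
    obtain ⟨a, ha⟩ := exists_IOI_mem_iff (hinf.mono (Set.subset_union_right (s := ↑σ)))
    have haES : a ∈ ES σ s' := by
      refine ⟨fun m hm => (ha m).2 (Or.inl hm), fun n hn hnσ => ?_⟩
      have hns := ((ha n).1 hn).resolve_left hnσ
      exact ⟨hns, fun m hm => hlt m hm n hns⟩
    exact Set.eq_empty_iff_forall_notMem.1 hdisj a ⟨haES, hsub (ES_mono hs' haES)⟩

/-- For a tree, `[σ,s] ⊆ C_T` is a statement about finite subsets of `s` only. -/
theorem ES_subset_treeClosedSet_iff {T : List ℕ → Bool}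
    (hT : ∀ l n, T (l ++ [n]) = true → T l = true)
    {σ : Finset ℕ} {s : Set ℕ} (hσs : GoodPair σ s) :
    ES σ s ⊆ treeClosedSet T ↔
      ∀ τ : Finset ℕ, ↑τ ⊆ s → T ((σ ∪ τ).sort (· ≤ ·)) = true := by
  constructor
  · intro h τ hτ
    have hinf : {n ∈ s | ∀ m ∈ τ, m < n}.Infinite :=
      (hσs.1.sdiff (Set.finite_Iic (τ.sup id))).mono fun n hn =>
        ⟨hn.1, fun m hm => (Finset.le_sup (f := id) hm).trans_lt (not_le.1 hn.2)⟩
    obtain ⟨a, ha⟩ := exists_IOI_mem_iff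
      (hinf.mono (Set.subset_union_right (s := (↑(σ ∪ τ) : Set ℕ))))
    have hσlt : ∀ n ∈ s, ∀ m ∈ σ, m < n := fun n hn m hm => hσs.2 m hm n hn
    rw [← enumList_card_eq_sort (a := a)]
    · refine h ⟨fun m hm => (ha m).2 (Or.inl (by simp [hm])), fun n hn hnσ => ?_⟩ _
      have hns : n ∈ s := by
        rcases (ha n).1 hn with hn | hn
        · exact hτ ((Finset.mem_union.1 hn).resolve_left hnσ)
        · exact hn.1
      exact ⟨hns, hσlt n hns⟩
    · exact fun n hn => (ha n).2 (Or.inl hn)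
    · intro n hn hnF m hm
      have hn' := ((ha n).1 hn).resolve_left hnF
      rcases Finset.mem_union.1 hm with hm | hm
      · exact hσlt n hn'.1 m hm
      · exact hn'.2 m hm
  · intro h a ha k
    have hlong : T (enumList a (k + (σ.sup id + 1))) = true := by
      rw [enumList_eq_sort_filter]
      set F := (Finset.range (Nat.nth (fun n => a.1 n = true) (k + (σ.sup id + 1)))).filter
        fun n => a.1 n = true with hF
      have hσF : σ ⊆ F := by
        intro m hm
        refine Finset.mem_filter.2 ⟨Finset.mem_range.2 ?_, ha.1 m hm⟩
        have h₁ : m ≤ σ.sup id := Finset.le_sup (f := id) hm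
        have h₂ := (Nat.nth_strictMono (p := fun n => a.1 n = true) a.2).le_apply
          (x := k + (σ.sup id + 1))
        omega
      rw [← Finset.union_sdiff_of_subset hσF]
      refine h _ fun n hn => ?_
      rw [Finset.mem_coe, Finset.mem_sdiff] at hn
      exact (ha.2 n (Finset.mem_filter.1 hn.1).2 hn.2).1
    have hdown : ∀ j, T (enumList a (k + j)) = true → T (enumList a k) = true := by
      intro j
      induction j with
      | zero => exact id
      | succ j ih =>
        intro hj
        refine ih (hT _ (Nat.nth (fun n => a.1 n = true) (k + j)) ?_)
        simpa [enumList, ← add_assoc, List.range_succ] using hj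
    exact hdown _ hlong

theorem setOf_prunedIncTree_ramseyPositive_eq :
    {T : List ℕ → Bool | PrunedIncTree T ∧ RamseyPositive (treeClosedSet T)} =
      ⋃ σ : Finset ℕ, Prod.snd '' {p : (ℕ → Bool) × (List ℕ → Bool) |
        PrunedIncTree p.2 ∧ (∀ k, ∃ n, k < n ∧ p.1 n = true) ∧
        (∀ m ∈ σ, ∀ n, p.1 n = true → m < n) ∧
        ∀ τ : Finset ℕ, (∀ n ∈ τ, p.1 n = true) →
          p.2 ((σ ∪ τ).sort (· ≤ ·)) = true} := by
  classical
  ext T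
  simp only [Set.mem_ofPred_eq, Set.mem_iUnion, Set.mem_image, Prod.exists,
    exists_eq_right, ramseyPositive_treeClosedSet_iff]
  constructor
  · rintro ⟨hT, σ, s, hσs, hsub⟩
    rw [ES_subset_treeClosedSet_iff hT.2.2.1 hσs] at hsub
    refine ⟨σ, fun n => decide (n ∈ s), hT, fun k => ?_, ?_, fun τ hτ => hsub τ ?_⟩
    · obtain ⟨n, hn, hkn⟩ := hσs.1.exists_gt k
      exact ⟨n, hkn, by simpa using hn⟩
    · simpa using hσs.2
    · exact fun n hn => by simpa using hτ n hn
  · rintro ⟨σ, x, hT, hinf, hlt, hsub⟩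
    have hσs : GoodPair σ {n | x n = true} :=
      ⟨Set.infinite_of_forall_exists_gt fun k => (hinf k).imp fun n hn => ⟨hn.2, hn.1⟩, hlt⟩
    refine ⟨hT, σ, _, hσs, ?_⟩
    rw [ES_subset_treeClosedSet_iff hT.2.2.1 hσs]
    exact hsub

theorem measurableSet_prunedIncTree_witness (σ : Finset ℕ) :
    MeasurableSet {p : (ℕ → Bool) × (List ℕ → Bool) |
      PrunedIncTree p.2 ∧ (∀ k, ∃ n, k < n ∧ p.1 n = true) ∧
      (∀ m ∈ σ, ∀ n, p.1 n = true → m < n) ∧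
      ∀ τ : Finset ℕ, (∀ n ∈ τ, p.1 n = true) →
        p.2 ((σ ∪ τ).sort (· ≤ ·)) = true} := by
  have hfst : ∀ n, Measurable fun p : (ℕ → Bool) × (List ℕ → Bool) => p.1 n = true :=
    fun n => measurableSet_setOfPred.1 (measurableSet_eq_fun (by fun_prop) (by fun_prop))
  have hsnd : ∀ l, Measurable fun p : (ℕ → Bool) × (List ℕ → Bool) => p.2 l = true :=
    fun l => measurableSet_setOfPred.1 (measurableSet_eq_fun (by fun_prop) (by fun_prop))
  refine measurableSet_setOfPred.2 ?_
  unfold PrunedIncTree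
  refine .and (.and (hsnd _) (.and ?_ (.and ?_ ?_))) (.and ?_ (.and ?_ ?_))
  · exact .forall fun l => (hsnd l).imp measurable_const
  · exact .forall fun l => .forall fun n => (hsnd _).imp (hsnd l)
  · exact .forall fun l => (hsnd l).imp (.exists fun n => hsnd _)
  · exact .forall fun k => .exists fun n => measurable_const.and (hfst n)
  · exact .forall fun m => .imp measurable_const (.forall fun n => (hfst n).imp measurable_const)
  · exact .forall fun τ => .imp (.forall fun n => .imp measurable_const (hfst n)) (hsnd _)

/-- The set of pruned trees of strictly increasing finite sequences coding a Ramsey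
positive closed set is analytic in `2^(ℕ^{<ℕ})`. -/
theorem statement3 :
    AnalyticSet {T : List ℕ → Bool |
      PrunedIncTree T ∧ RamseyPositive (treeClosedSet T)} := by
  have : TopologicalSpace.IsCompletelyMetrizableSpace (ℕ → Bool) := inferInstance
  have : TopologicalSpace.IsCompletelyMetrizableSpace (List ℕ → Bool) := inferInstance
  have : PolishSpace ((ℕ → Bool) × (List ℕ → Bool)) := inferInstance
  rw [setOf_prunedIncTree_ramseyPositive_eq]
  exact .iUnion fun σ =>
    (measurableSet_prunedIncTree_witness σ).analyticSet.image_of_continuous continuous_snd
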